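/- arXiv:2206.07224 — 2 statements merged into one kernel-verified Lean document; each statement's English description precedes it below -/
import Mathlib

section
/- Let t₀ ∈ ℝ and ẑ > 0. Let a, l : ℝ → ℝ be continuous with l(t) ≥ 0 for all t ≥ t₀, and set μ(t) = a(t) + l(t) and Z_h(t) = exp(∫_{t₀}^t μ(s) ds). Assume S := sup_{t ≥ t₀} Z_h(t) < ∞. Let L : ℝ × ℝ → ℝ be continuous, locally Lipschitz in its second argument, with 0 ≤ L(t, u) ≤ l(t) · u for all t ≥ t₀ and u ∈ [0, ẑ]. Let z : ℝ → ℝ be differentiable on [t₀, ∞), nonnegative, with z'(t) = a(t) z(t) + L(t, z(t)) for all t ≥ t₀ and initial value z(t₀) = z₀ satisfying 0 ≤ z₀ < ẑ / S. Then for all t ≥ t₀ one has z(t) ≤ z₀ · Z_h(t) < ẑ; in particular, if moreover Z_h(t) → 0 as t → ∞, then z(t) → 0 as t → ∞. -/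
open Real Filter Set

/-- A function with `z' ≤ μ z` on `(t₀, T)` is bounded at `T` by the solution of the linear
equation with the same initial value. -/
theorem le_mul_exp_integral_of_deriv_le {t₀ T : ℝ} (hT : t₀ ≤ T) {μ z : ℝ → ℝ}
    (hμ : Continuous μ) (hz : ∀ t ∈ Icc t₀ T, DifferentiableAt ℝ z t)
    (hle : ∀ t ∈ Ioo t₀ T, deriv z t ≤ μ t * z t) :
    z T ≤ z t₀ * Real.exp (∫ s in t₀..T, μ s) := by
  have hderiv : ∀ t ∈ Icc t₀ T,
      HasDerivAt (fun t => z t * Real.exp (-∫ s in t₀..t, μ s))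
        ((deriv z t - μ t * z t) * Real.exp (-∫ s in t₀..t, μ s)) t := by
    intro t ht
    have hM : HasDerivAt (fun t => ∫ s in t₀..t, μ s) (μ t) t :=
      intervalIntegral.integral_hasDerivAt_right (hμ.intervalIntegrable _ _)
        (hμ.stronglyMeasurableAtFilter _ _) hμ.continuousAt
    refine ((hz t ht).hasDerivAt.mul hM.fun_neg.exp).congr_deriv ?_
    ring
  have hanti : AntitoneOn (fun t => z t * Real.exp (-∫ s in t₀..t, μ s)) (Icc t₀ T) := by
    refine antitoneOn_of_deriv_nonpos (convex_Icc _ _)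
      (fun t ht => (hderiv t ht).continuousAt.continuousWithinAt) ?_ ?_ <;>
      rw [interior_Icc] <;> intro t ht
    · exact (hderiv t (Ioo_subset_Icc_self ht)).differentiableAt.differentiableWithinAt
    · rw [(hderiv t (Ioo_subset_Icc_self ht)).deriv]
      exact mul_nonpos_of_nonpos_of_nonneg (sub_nonpos.2 (hle t ht)) (Real.exp_pos _).le
  have h := hanti (left_mem_Icc.2 hT) (right_mem_Icc.2 hT) hT
  simp only [intervalIntegral.integral_same, neg_zero, Real.exp_zero, mul_one,
    Real.exp_neg] at h
  rwa [← div_eq_mul_inv, div_le_iff₀ (Real.exp_pos _)] at h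

/-- Continuity bootstrap: if a continuous function on `[t₀, ∞)` is strictly below a level at
every time up to which it has not exceeded that level, it always stays strictly below. -/
theorem lt_of_bootstrap {t₀ c : ℝ} {z : ℝ → ℝ} (hz : ContinuousOn z (Ici t₀))
    (h : ∀ T ≥ t₀, (∀ t ∈ Ioo t₀ T, z t ≤ c) → z T < c) : ∀ t ≥ t₀, z t < c := by
  intro T hT
  by_contra! hc
  have hcl : IsClosed (Icc t₀ T ∩ z ⁻¹' Ici c) :=
    (hz.mono Icc_subset_Ici_self).preimage_isClosed_of_isClosed isClosed_Icc isClosed_Ici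
  obtain ⟨t₁, ⟨⟨h₀, hT₁⟩, ht₁⟩, hmin⟩ :=
    (isCompact_Icc.of_isClosed_subset hcl inter_subset_left).exists_isLeast
      ⟨T, right_mem_Icc.2 hT, hc⟩
  refine (h t₁ h₀ fun t ht => ?_).not_ge ht₁
  by_contra! hlt
  exact (hmin ⟨⟨ht.1.le, ht.2.le.trans hT₁⟩, hlt.le⟩).not_gt ht.2

/-- Scalar core of Theorem 2: the nonlinear auxiliary equation `ż = a(t) z + L(t, z)` is
linearized on `[0, ẑ]` via `L(t,u) ≤ l(t) u`, and stability of the linear majorant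
`Ż = (a + l)(t) Z` (i.e. `S = sup_{t ≥ t₀} Z_h(t) < ∞`) yields, for solutions with
`0 ≤ z₀ < ẑ / S`, the bound `z(t) ≤ z₀ Z_h(t) < ẑ` for all `t ≥ t₀`, and asymptotic
stability whenever `Z_h(t) → 0`. -/
theorem theorem2_scalar_core (t₀ zhat : ℝ) (hzhat : 0 < zhat)
    (a l : ℝ → ℝ) (ha : Continuous a) (hl : Continuous l)
    (hl0 : ∀ t ≥ t₀, 0 ≤ l t)
    (μ : ℝ → ℝ) (hμ : ∀ t, μ t = a t + l t)
    (Zh : ℝ → ℝ) (hZh : ∀ t, Zh t = Real.exp (∫ s in t₀..t, μ s))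
    (hbdd : BddAbove (Zh '' Set.Ici t₀))
    (S : ℝ) (hS : S = sSup (Zh '' Set.Ici t₀))
    (L : ℝ × ℝ → ℝ) (hLcont : Continuous L)
    (hLlip : ∀ t : ℝ, LocallyLipschitz fun u : ℝ => L (t, u))
    (hLnn : ∀ t ≥ t₀, ∀ u ∈ Set.Icc (0 : ℝ) zhat, 0 ≤ L (t, u))
    (hLle : ∀ t ≥ t₀, ∀ u ∈ Set.Icc (0 : ℝ) zhat, L (t, u) ≤ l t * u)
    (z : ℝ → ℝ) (hzdiff : ∀ t ≥ t₀, DifferentiableAt ℝ z t)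
    (hznn : ∀ t ≥ t₀, 0 ≤ z t)
    (hzode : ∀ t ≥ t₀, deriv z t = a t * z t + L (t, z t))
    (z₀ : ℝ) (hz₀ : z t₀ = z₀) (hz₀nn : 0 ≤ z₀) (hz₀lt : z₀ < zhat / S) :
    (∀ t ≥ t₀, z t ≤ z₀ * Zh t ∧ z₀ * Zh t < zhat) ∧
      (Tendsto Zh atTop (nhds 0) → Tendsto z atTop (nhds 0)) := by
  have hμc : Continuous μ := by
    rw [funext hμ]
    exact ha.add hl
  have hZS : ∀ t ≥ t₀, Zh t ≤ S := fun t ht => hS ▸ le_csSup hbdd (mem_image_of_mem Zh ht)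
  have hSpos : 0 < S := by
    refine lt_of_lt_of_le ?_ (hZS t₀ le_rfl)
    rw [hZh]
    exact Real.exp_pos _
  have hlt : ∀ t ≥ t₀, z₀ * Zh t < zhat := fun t ht =>
    (mul_le_mul_of_nonneg_left (hZS t ht) hz₀nn).trans_lt ((lt_div_iff₀ hSpos).1 hz₀lt)
  have hlin : ∀ T ≥ t₀, (∀ t ∈ Ioo t₀ T, z t ≤ zhat) → z T ≤ z₀ * Zh T := by
    intro T hT hb
    rw [← hz₀, hZh]
    refine le_mul_exp_integral_of_deriv_le hT hμc (fun t ht => hzdiff t ht.1) fun t ht => ?_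
    rw [hzode t ht.1.le, hμ]
    linarith [hLle t ht.1.le (z t) ⟨hznn t ht.1.le, hb t ht⟩]
  have hzlt : ∀ t ≥ t₀, z t < zhat :=
    lt_of_bootstrap (fun t ht => (hzdiff t ht).continuousAt.continuousWithinAt)
      fun T hT hb => (hlin T hT hb).trans_lt (hlt T hT)
  have hbound : ∀ t ≥ t₀, z t ≤ z₀ * Zh t := fun T hT =>
    hlin T hT fun t ht => (hzlt t ht.1.le).le
  refine ⟨fun t ht => ⟨hbound t ht, hlt t ht⟩, fun hZ => ?_⟩
  refine tendsto_of_tendsto_of_tendsto_of_le_of_le' tendsto_const_nhds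
    (by simpa using hZ.const_mul z₀) ?_ ?_
  · filter_upwards [eventually_ge_atTop t₀] with t ht using hznn t ht
  · filter_upwards [eventually_ge_atTop t₀] with t ht using hbound t ht
end

section
/- Let t₀ ∈ ℝ and ẑ > 0. Let a, l, Fn : ℝ → ℝ be continuous with l(t) ≥ 0 and Fn(t) ≥ 0 for all t ≥ t₀; set μ(t) = a(t) + l(t), Z_h(t) = exp(∫_{t₀}^t μ(s) ds), and Z_F(t) = ∫_{t₀}^t exp(∫_{τ}^t μ(s) ds) · Fn(τ) dτ. Assume S_h := sup_{t ≥ t₀} Z_h(t) < ∞ and S_F := sup_{t ≥ t₀} Z_F(t) < ∞. Let L : ℝ × ℝ → ℝ be continuous, locally Lipschitz in its second argument, with 0 ≤ L(t, u) ≤ l(t) · u for all t ≥ t₀ and u ∈ [0, ẑ]. Let z : ℝ → ℝ be differentiable on [t₀, ∞), nonnegative, with z'(t) = a(t) z(t) + L(t, z(t)) + Fn(t) for all t ≥ t₀ and initial value z(t₀) = z₀ satisfying z₀ ≥ 0 and z₀ · S_h + S_F < ẑ. Then for all t ≥ t₀ one has z(t) ≤ z₀ · Z_h(t) + Z_F(t)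 ≤ z₀ · S_h + S_F < ẑ; in particular, if moreover Z_h(t) → 0 as t → ∞, then limsup_{t → ∞} z(t) ≤ S_F. -/
open Real Filter Set

/-- Comparison with a linear majorant: as long as the nonlinear part of the equation is dominated by
`l t * z t`, the solution stays below the solution of the linear majorant. -/
theorem le_linear_majorant {t₀ T : ℝ} (hT : t₀ ≤ T) {a l f g z : ℝ → ℝ}
    (ha : Continuous a) (hl : Continuous l) (hf : Continuous f)
    (hz : ∀ t ∈ Icc t₀ T, HasDerivAt z (a t * z t + g t + f t) t)
    (hg : ∀ t ∈ Ioo t₀ T, g t ≤ l t * z t) :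
    z T ≤ z t₀ * Real.exp (∫ s in t₀..T, (a s + l s)) +
      ∫ τ in t₀..T, Real.exp (∫ s in τ..T, (a s + l s)) * f τ := by
  have hμ : Continuous fun s => a s + l s := ha.add hl
  set M : ℝ → ℝ := fun t => ∫ s in t₀..t, (a s + l s)
  have hM' : ∀ t, HasDerivAt M (a t + l t) t := fun t =>
    (hμ.integral_hasStrictDerivAt t₀ t).hasDerivAt
  have hMc : Continuous M := continuous_iff_continuousAt.2 fun t => (hM' t).continuousAt
  have hE : Continuous fun t => Real.exp (-M t) * f t := by fun_prop
  have hw : ∀ t ∈ Icc t₀ T, HasDerivAt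
      (fun t => Real.exp (-M t) * z t - ∫ τ in t₀..t, Real.exp (-M τ) * f τ)
      (Real.exp (-M t) * (g t - l t * z t)) t := by
    intro t ht
    refine (((hM' t).fun_neg.exp.fun_mul (hz t ht)).fun_sub
      (hE.integral_hasStrictDerivAt t₀ t).hasDerivAt).congr_deriv ?_
    ring
  have hanti := antitoneOn_of_deriv_nonpos (convex_Icc t₀ T)
    (fun t ht => (hw t ht).continuousAt.continuousWithinAt)
    (fun t ht => (hw t (interior_subset ht)).differentiableAt.differentiableWithinAt)
    (fun t ht => by
      rw [(hw t (interior_subset ht)).deriv]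
      rw [interior_Icc] at ht
      exact mul_nonpos_of_nonneg_of_nonpos (Real.exp_pos _).le (sub_nonpos.2 (hg t ht)))
  have hle := hanti (left_mem_Icc.2 hT) (right_mem_Icc.2 hT) hT
  have hM0 : M t₀ = 0 := intervalIntegral.integral_same
  have hsplit : ∀ τ, Real.exp (∫ s in τ..T, (a s + l s)) * f τ =
      Real.exp (M T) * (Real.exp (-M τ) * f τ) := by
    intro τ
    rw [← intervalIntegral.integral_interval_sub_left (hμ.intervalIntegrable t₀ T)
      (hμ.intervalIntegrable t₀ τ), sub_eq_add_neg, Real.exp_add, mul_assoc]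
  simp only [hsplit, intervalIntegral.integral_const_mul]
  simp only [hM0, neg_zero, Real.exp_zero, one_mul, intervalIntegral.integral_same, sub_zero] at hle
  have hexp : Real.exp (M T) * Real.exp (-M T) = 1 := by rw [← Real.exp_add]; simp
  calc z T = Real.exp (M T) * (Real.exp (-M T) * z T) := by rw [← mul_assoc, hexp, one_mul]
    _ ≤ Real.exp (M T) * (z t₀ + ∫ τ in t₀..T, Real.exp (-M τ) * f τ) := by
      gcongr
      linarith
    _ = _ := by ring

/-- A function that is continuous on `[t₀, ∞)` stays below `c` if it does so at every time up to
which it has stayed below `c`. -/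
theorem lt_of_forall_lt_before {t₀ c : ℝ} {z : ℝ → ℝ} (hz : ContinuousOn z (Ici t₀))
    (h : ∀ T ≥ t₀, (∀ t ∈ Ico t₀ T, z t < c) → z T < c) : ∀ t ≥ t₀, z t < c := by
  by_contra! ⟨t, ht, htc⟩
  set S := Ici t₀ ∩ z ⁻¹' Ici c
  have hS : IsClosed S := hz.preimage_isClosed_of_isClosed isClosed_Ici isClosed_Ici
  have hbdd : BddBelow S := ⟨t₀, fun _ hs => hs.1⟩
  have hmem : sInf S ∈ S := hS.csInf_mem ⟨t, ht, htc⟩ hbdd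
  refine (h _ hmem.1 fun s hs => ?_).not_ge hmem.2
  by_contra! hc
  exact (csInf_le hbdd ⟨hs.1, hc⟩).not_gt hs.2

/-- Scalar core of Theorem 3: for the nonhomogeneous nonlinear auxiliary equation
`ż = a(t) z + L(t, z) + Fn(t)`, linearized on `[0, ẑ]` via `L(t,u) ≤ l(t) u`, stability of the
homogeneous linear majorant (`S_h < ∞`) and boundedness of the forced response (`S_F < ∞`),
together with `z₀ S_h + S_F < ẑ`, yield `z(t) ≤ z₀ Z_h(t) + Z_F(t) ≤ z₀ S_h + S_F < ẑ` for all
`t ≥ t₀`, and `limsup_{t → ∞} z(t) ≤ S_F` whenever `Z_h(t) → 0`. -/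
theorem theorem3_scalar_core (t₀ zhat : ℝ) (hzhat : 0 < zhat)
    (a l Fn : ℝ → ℝ) (ha : Continuous a) (hl : Continuous l) (hFn : Continuous Fn)
    (hl0 : ∀ t ≥ t₀, 0 ≤ l t) (hFn0 : ∀ t ≥ t₀, 0 ≤ Fn t)
    (μ : ℝ → ℝ) (hμ : ∀ t, μ t = a t + l t)
    (Zh : ℝ → ℝ) (hZh : ∀ t, Zh t = Real.exp (∫ s in t₀..t, μ s))
    (ZF : ℝ → ℝ)
    (hZF : ∀ t, ZF t = ∫ τ in t₀..t, Real.exp (∫ s in τ..t, μ s) * Fn τ)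
    (hbddh : BddAbove (Zh '' Set.Ici t₀)) (hbddF : BddAbove (ZF '' Set.Ici t₀))
    (Sh SF : ℝ) (hSh : Sh = sSup (Zh '' Set.Ici t₀)) (hSF : SF = sSup (ZF '' Set.Ici t₀))
    (L : ℝ × ℝ → ℝ) (hLcont : Continuous L)
    (hLlip : ∀ t : ℝ, LocallyLipschitz fun u : ℝ => L (t, u))
    (hLnn : ∀ t ≥ t₀, ∀ u ∈ Set.Icc (0 : ℝ) zhat, 0 ≤ L (t, u))
    (hLle : ∀ t ≥ t₀, ∀ u ∈ Set.Icc (0 : ℝ) zhat, L (t, u) ≤ l t * u)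
    (z : ℝ → ℝ) (hzdiff : ∀ t ≥ t₀, DifferentiableAt ℝ z t)
    (hznn : ∀ t ≥ t₀, 0 ≤ z t)
    (hzode : ∀ t ≥ t₀, deriv z t = a t * z t + L (t, z t) + Fn t)
    (z₀ : ℝ) (hz₀ : z t₀ = z₀) (hz₀nn : 0 ≤ z₀) (hz₀lt : z₀ * Sh + SF < zhat) :
    (∀ t ≥ t₀, z t ≤ z₀ * Zh t + ZF t ∧ z₀ * Zh t + ZF t ≤ z₀ * Sh + SF) ∧
      (Tendsto Zh atTop (nhds 0) → limsup z atTop ≤ SF) := by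
  obtain rfl : μ = fun t => a t + l t := funext hμ
  have hzd : ∀ t ≥ t₀, HasDerivAt z (a t * z t + L (t, z t) + Fn t) t := fun t ht =>
    hzode t ht ▸ (hzdiff t ht).hasDerivAt
  have hZFle : ∀ t ≥ t₀, ZF t ≤ SF := fun t ht => hSF ▸ le_csSup hbddF ⟨t, ht, rfl⟩
  have hmaj : ∀ t ≥ t₀, z₀ * Zh t + ZF t ≤ z₀ * Sh + SF := fun t ht =>
    add_le_add (mul_le_mul_of_nonneg_left (hSh ▸ le_csSup hbddh ⟨t, ht, rfl⟩) hz₀nn) (hZFle t ht)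
  have hcomp : ∀ T ≥ t₀, (∀ t ∈ Ico t₀ T, z t < zhat) → z T ≤ z₀ * Zh T + ZF T := by
    intro T hT hlt
    rw [hZh, hZF, ← hz₀]
    exact le_linear_majorant hT ha hl hFn (fun t ht => hzd t ht.1) fun t ht =>
      hLle t ht.1.le _ ⟨hznn t ht.1.le, (hlt t ⟨ht.1.le, ht.2⟩).le⟩
  have hlt : ∀ t ≥ t₀, z t < zhat :=
    lt_of_forall_lt_before (fun t ht => (hzdiff t ht).continuousAt.continuousWithinAt)
      fun T hT h => ((hcomp T hT h).trans (hmaj T hT)).trans_lt hz₀lt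
  have hle : ∀ t ≥ t₀, z t ≤ z₀ * Zh t + ZF t := fun t ht =>
    hcomp t ht fun s hs => hlt s hs.1
  refine ⟨fun t ht => ⟨hle t ht, hmaj t ht⟩, fun hZh0 => ?_⟩
  have hlim : Tendsto (fun t => z₀ * Zh t + SF) atTop (nhds SF) := by
    simpa using (hZh0.const_mul z₀).add_const SF
  rw [← hlim.limsup_eq]
  refine limsup_le_limsup ?_ ?_ hlim.isBoundedUnder_le
  · filter_upwards [eventually_ge_atTop t₀] with t ht
    exact (hle t ht).trans (add_le_add_right (hZFle t ht) _)
  · exact IsBoundedUnder.isCoboundedUnder_le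
      ⟨0, eventually_map.2 ((eventually_ge_atTop t₀).mono hznn)⟩
end
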